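/- (a) (S_n − n(2p−1)X_1)/√(4np(1−p)) converges in distribution to a standard normal random variable as n → ∞. (b) (S_n − n(2p−1)X_1)/n → 0 almost surely as n → ∞; equivalently, S_n/n → (2p−1)X_1 almost surely. (c) limsup_{n→∞} (S_n − n(2p−1)X_1)/√(8np(1−p) log log n) = 1 and liminf_{n→∞} (S_n − n(2p−1)X_1)/√(8np(1−p) log log n) = −1 almost surely. -/

import Mathlib

open MeasureTheory ProbabilityTheory Filter Topology

noncomputable section

/-- The σ-algebra generated by the steps `X 1, …, X n`. -/
def sigmaUpTo {Ω : Type*} (X : ℕ → Ω → ℝ) (n : ℕ) : MeasurableSpace Ω :=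
  ⨆ i ∈ Finset.Icc 1 n, MeasurableSpace.comap (X i) inferInstance

/-- The σ-algebra generated by all the steps `X 1, X 2, …`. -/
def sigmaAll {Ω : Type*} (X : ℕ → Ω → ℝ) : MeasurableSpace Ω :=
  ⨆ i ∈ Set.Ici 1, MeasurableSpace.comap (X i) inferInstance

/-- The partial sum `X 1 + ⋯ + X n` of the walk. -/
def partialSum {Ω : Type*} (X : ℕ → Ω → ℝ) (n : ℕ) (ω : Ω) : ℝ :=
  ∑ k ∈ Finset.Icc 1 n, X k ω

/-- Convergence in distribution of the random variables `f n` to the law `ν`,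
expressed as weak convergence tested against bounded continuous functions. -/
def TendstoInDistribution {Ω : Type*} [MeasurableSpace Ω] (μ : Measure Ω)
    (f : ℕ → Ω → ℝ) (ν : Measure ℝ) : Prop :=
  ∀ g : BoundedContinuousFunction ℝ ℝ,
    Tendsto (fun n => ∫ ω, g (f n ω) ∂μ) atTop (𝓝 (∫ x, g x ∂ν))

/-- A sequence of independent, centred random variables of unit variance, all bounded by `C`. -/
structure IsStandardBoundedSeq {Ω : Type*} [MeasurableSpace Ω] (μ : Measure Ω)
    (ξ : ℕ → Ω → ℝ) (C : ℝ) : Prop where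
  one_le : 1 ≤ C
  measurable : ∀ i, Measurable (ξ i)
  bound : ∀ i, ∀ᵐ ω ∂μ, |ξ i ω| ≤ C
  mean : ∀ i, ∫ ω, ξ i ω ∂μ = 0
  second_moment : ∀ i, ∫ ω, ξ i ω ^ 2 ∂μ = 1
  indep : iIndepFun ξ μ

theorem integrable_of_ae_abs_le {Ω : Type*} [MeasurableSpace Ω] {μ : Measure Ω}
    [IsFiniteMeasure μ] {f : Ω → ℝ} {C : ℝ} (hf : Measurable f) (hC : ∀ᵐ ω ∂μ, |f ω| ≤ C) :
    Integrable f μ :=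
  .of_bound hf.aestronglyMeasurable C (by simpa using hC)

theorem integrable_exp_mul_of_ae_abs_le {Ω : Type*} [MeasurableSpace Ω] {μ : Measure Ω}
    [IsFiniteMeasure μ] {f : Ω → ℝ} {C : ℝ} (hf : Measurable f) (hC : ∀ᵐ ω ∂μ, |f ω| ≤ C)
    (t : ℝ) : Integrable (fun ω => Real.exp (t * f ω)) μ := by
  refine integrable_of_ae_abs_le (C := Real.exp (|t| * C)) (by fun_prop) ?_
  filter_upwards [hC] with ω h
  rw [abs_of_pos (Real.exp_pos _), Real.exp_le_exp]
  calc t * f ω ≤ |t * f ω| := le_abs_self _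
    _ = |t| * |f ω| := abs_mul _ _
    _ ≤ |t| * C := by gcongr

theorem abs_mgf_sub_le {Ω : Type*} [MeasurableSpace Ω] {μ : Measure Ω} [IsProbabilityMeasure μ]
    {X : Ω → ℝ} {C t : ℝ} (hX : Measurable X) (hC : ∀ᵐ ω ∂μ, |X ω| ≤ C)
    (hmean : ∫ ω, X ω ∂μ = 0) (hvar : ∫ ω, X ω ^ 2 ∂μ = 1) (ht : |t| * C ≤ 1) :
    |mgf X μ t - (1 + t ^ 2 / 2)| ≤ (|t| * C) ^ 3 := by
  have hXi : Integrable X μ := integrable_of_ae_abs_le hX hC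
  have hX2 : Integrable (fun ω => X ω ^ 2) μ := by
    refine integrable_of_ae_abs_le (C := C ^ 2) (by fun_prop) ?_
    filter_upwards [hC] with ω h
    rw [abs_pow]
    gcongr
  have hexp := integrable_exp_mul_of_ae_abs_le hX hC t
  have key : mgf X μ t - (1 + t ^ 2 / 2) =
      ∫ ω, (Real.exp (t * X ω) - (1 + t * X ω + t ^ 2 / 2 * X ω ^ 2)) ∂μ := by
    have h1 : Integrable (fun ω => 1 + t * X ω) μ := (integrable_const _).add (hXi.const_mul t)
    have h2 : Integrable (fun ω => 1 + t * X ω + t ^ 2 / 2 * X ω ^ 2) μ :=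
      h1.add (hX2.const_mul _)
    rw [integral_sub hexp h2,
      integral_add h1 (hX2.const_mul _), integral_add (integrable_const _) (hXi.const_mul t),
      integral_const_mul, integral_const_mul, hmean, hvar]
    simp [mgf]
  rw [key, ← Real.norm_eq_abs]
  refine (norm_integral_le_of_norm_le_const (C := (|t| * C) ^ 3) ?_).trans (by simp)
  filter_upwards [hC] with ω h
  have hle : |t * X ω| ≤ |t| * C := by rw [abs_mul]; gcongr
  have := Real.exp_bound (hle.trans ht) (n := 3) (by norm_num)
  simp only [Finset.sum_range_succ, Finset.sum_range_zero, Nat.factorial] at this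
  rw [Real.norm_eq_abs]
  have e : (1 : ℝ) + t * X ω + t ^ 2 / 2 * X ω ^ 2 = 0 + (t * X ω) ^ 0 / ((1 : ℕ) : ℝ) +
      (t * X ω) ^ 1 / (((0 + 1) * 1 : ℕ) : ℝ) +
      (t * X ω) ^ 2 / (((1 + 1) * ((0 + 1) * 1) : ℕ) : ℝ) := by
    push_cast; ring
  rw [e]
  refine this.trans ?_
  calc _ ≤ |t * X ω| ^ 3 * 1 := by gcongr; norm_num
    _ ≤ _ := by rw [mul_one]; gcongr

/-- Near the origin the moment generating function of a bounded standardized variable is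
comparable to that of the standard Gaussian. -/
theorem mgf_mem_Icc {Ω : Type*} [MeasurableSpace Ω] {μ : Measure Ω} [IsProbabilityMeasure μ]
    {X : Ω → ℝ} {C t η : ℝ} (hX : Measurable X) (h1 : 1 ≤ C) (hC : ∀ᵐ ω ∂μ, |X ω| ≤ C)
    (hmean : ∫ ω, X ω ∂μ = 0) (hvar : ∫ ω, X ω ^ 2 ∂μ = 1) (hη : 0 < η) (hη1 : η ≤ 1)
    (ht : |t| ≤ η / (4 * C ^ 3)) :
    mgf X μ t ∈ Set.Icc (Real.exp (t ^ 2 / 2 * (1 - η))) (Real.exp (t ^ 2 / 2 * (1 + η))) := by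
  have hC3 : 1 ≤ C ^ 3 := one_le_pow₀ h1
  have htC : |t| * C ^ 3 ≤ η / 4 := by
    rw [le_div_iff₀ (by positivity)] at ht
    linarith
  have hCC : C ≤ C ^ 3 := le_self_pow₀ h1 (by norm_num)
  have htη : |t| ≤ η / 4 := by nlinarith [abs_nonneg t]
  have htC1 : |t| * C ≤ 1 := by nlinarith [abs_nonneg t]
  have hb := abs_mgf_sub_le hX hC hmean hvar htC1
  have hu : (|t| * C) ^ 3 ≤ t ^ 2 / 2 * (η / 2) := by
    calc (|t| * C) ^ 3 = |t| ^ 2 * (|t| * C ^ 3) := by ring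
      _ ≤ |t| ^ 2 * (η / 4) := by gcongr
      _ = _ := by rw [sq_abs]; ring
  have hu2 : t ^ 2 / 2 ≤ η / 2 := by
    rw [← sq_abs]; nlinarith [abs_nonneg t]
  have hu0 : 0 ≤ t ^ 2 / 2 := by positivity
  set u := t ^ 2 / 2
  have hb' := abs_le.1 (hb.trans hu)
  constructor
  · have hw : 0 < 1 - u * (1 - η) := by nlinarith
    have h2 : Real.exp (u * (1 - η)) ≤ 1 / (1 - u * (1 - η)) := by
      rw [le_div_iff₀ hw, ← le_div_iff₀' (Real.exp_pos _), one_div, ← Real.exp_neg]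
      linarith [Real.add_one_le_exp (-(u * (1 - η)))]
    refine h2.trans ?_
    rw [div_le_iff₀ hw]
    have h3 : 1 + u * (1 - η / 2) ≤ mgf X μ t := by linarith [hb'.1]
    have : 1 ≤ (1 + u * (1 - η / 2)) * (1 - u * (1 - η)) := by
      nlinarith [mul_nonneg hu0 (sub_nonneg.2 hu2), mul_nonneg hu0 hη.le,
        mul_nonneg hu0 hu0, mul_nonneg (mul_nonneg hu0 hu0) hη.le,
        mul_nonneg (mul_nonneg hu0 hu0) (sub_nonneg.2 hη1),
        mul_nonneg (mul_nonneg (mul_nonneg hu0 hu0) hη.le) (sub_nonneg.2 hη1)]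
    nlinarith
  · have := Real.add_one_le_exp (u * (1 + η))
    nlinarith [hb'.2]

namespace IsStandardBoundedSeq

variable {Ω : Type*} [MeasurableSpace Ω] {μ : Measure Ω} {ξ : ℕ → Ω → ℝ} {C : ℝ}

theorem neg (h : IsStandardBoundedSeq μ ξ C) : IsStandardBoundedSeq μ (fun i ω => -ξ i ω) C where
  one_le := h.one_le
  measurable i := (h.measurable i).neg
  bound i := by simpa using h.bound i
  mean i := by rw [integral_neg, h.mean, neg_zero]
  second_moment i := by simpa using h.second_moment i
  indep := h.indep.comp (fun _ x => -x) fun _ => measurable_neg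

variable [IsProbabilityMeasure μ]

theorem integrable_exp_sum (h : IsStandardBoundedSeq μ ξ C) (s : Finset ℕ) (t : ℝ) :
    Integrable (fun ω => Real.exp (t * ∑ i ∈ s, ξ i ω)) μ := by
  refine integrable_exp_mul_of_ae_abs_le (C := ∑ i ∈ s, C)
    (Finset.measurable_fun_sum _ fun i _ => h.measurable i) ?_ t
  filter_upwards [ae_all_iff.2 h.bound] with ω hω
  exact (Finset.abs_sum_le_sum_abs _ _).trans (Finset.sum_le_sum fun i _ => hω i)

theorem mgf_sum_mem_Icc (h : IsStandardBoundedSeq μ ξ C) (s : Finset ℕ) {t η : ℝ}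
    (hη : 0 < η) (hη1 : η ≤ 1) (ht : |t| ≤ η / (4 * C ^ 3)) :
    ∫ ω, Real.exp (t * ∑ i ∈ s, ξ i ω) ∂μ ∈
      Set.Icc (Real.exp (s.card * (t ^ 2 / 2) * (1 - η)))
        (Real.exp (s.card * (t ^ 2 / 2) * (1 + η))) := by
  have e : ∫ ω, Real.exp (t * ∑ i ∈ s, ξ i ω) ∂μ = ∏ i ∈ s, mgf (ξ i) μ t := by
    rw [← h.indep.mgf_sum h.measurable]
    simp [mgf]
  have hm i := mgf_mem_Icc (h.measurable i) h.one_le (h.bound i) (h.mean i) (h.second_moment i)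
    hη hη1 ht
  have hc (a : ℝ) : Real.exp (s.card * (t ^ 2 / 2) * a) =
      ∏ _i ∈ s, Real.exp (t ^ 2 / 2 * a) := by
    rw [Finset.prod_const, ← Real.exp_nat_mul, mul_assoc]
  rw [e, hc, hc]
  exact ⟨Finset.prod_le_prod (fun _ _ => (Real.exp_pos _).le) fun i _ => (hm i).1,
    Finset.prod_le_prod (fun _ _ => mgf_nonneg) fun i _ => (hm i).2⟩

theorem submartingale_exp (h : IsStandardBoundedSeq μ ξ C) (t : ℝ) :
    Submartingale (fun n ω => Real.exp (t * ∑ i ∈ Finset.range (n + 1), ξ i ω))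
      (Filtration.natural ξ fun i => (h.measurable i).stronglyMeasurable) μ := by
  have hadp : StronglyAdapted (Filtration.natural ξ fun i => (h.measurable i).stronglyMeasurable)
      fun n ω => Real.exp (t * ∑ i ∈ Finset.range (n + 1), ξ i ω) := by
    intro n
    refine Real.continuous_exp.comp_stronglyMeasurable
      (StronglyMeasurable.const_mul (Finset.stronglyMeasurable_fun_sum _ fun i hi => ?_) t)
    exact (Filtration.stronglyAdapted_natural _ i).mono
      (Filtration.mono _ (Nat.lt_succ_iff.1 (Finset.mem_range.1 hi)))
  refine submartingale_nat hadp (fun n => h.integrable_exp_sum _ t) fun n => ?_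
  have hstep : Integrable (fun ω => Real.exp (t * ξ (n + 1) ω)) μ :=
    integrable_exp_mul_of_ae_abs_le (h.measurable _) (h.bound _) t
  have hsplit : (fun ω => Real.exp (t * ∑ i ∈ Finset.range (n + 1 + 1), ξ i ω)) =
      (fun ω => Real.exp (t * ∑ i ∈ Finset.range (n + 1), ξ i ω)) *
        fun ω => Real.exp (t * ξ (n + 1) ω) := by
    ext ω
    rw [Finset.sum_range_succ, mul_add, Real.exp_add, Pi.mul_apply]
  have hpull := condExp_mul_of_aestronglyMeasurable_left (μ := μ)
    (hadp n).aestronglyMeasurable (hsplit ▸ h.integrable_exp_sum _ t) hstep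
  have hind := condExp_indep_eq (μ := μ) (f := fun ω => Real.exp (t * ξ (n + 1) ω))
    (h.measurable (n + 1)).comap_le (Filtration.le _ n)
    (((measurable_id.const_mul t).exp.comp (comap_measurable (ξ (n + 1)))).stronglyMeasurable)
    (h.indep.indep_comap_natural_of_lt
      (fun i => (h.measurable i).stronglyMeasurable) (Nat.lt_succ_self n))
  have hone : 1 ≤ ∫ ω, Real.exp (t * ξ (n + 1) ω) ∂μ := by
    have hi : Integrable (ξ (n + 1)) μ := integrable_of_ae_abs_le (h.measurable _) (h.bound _)
    calc (1 : ℝ) = ∫ ω, (t * ξ (n + 1) ω + 1) ∂μ := by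
          rw [integral_add (hi.const_mul t) (integrable_const _), integral_const_mul, h.mean]
          simp
      _ ≤ _ := integral_mono ((hi.const_mul t).add (integrable_const _)) hstep
          fun ω => Real.add_one_le_exp _
  simp only [hsplit]
  filter_upwards [hpull, hind] with ω h1 h2
  rw [h1, Pi.mul_apply, h2]
  exact le_mul_of_one_le_right (Real.exp_pos _).le hone

theorem measure_exists_le_sum_le (h : IsStandardBoundedSeq μ ξ C) {t : ℝ} (ht : 0 < t) (a : ℝ)
    (N : ℕ) :
    μ {ω | ∃ j ≤ N, a ≤ ∑ i ∈ Finset.range (j + 1), ξ i ω} ≤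
      ENNReal.ofReal (Real.exp (-(t * a)) *
        ∫ ω, Real.exp (t * ∑ i ∈ Finset.range (N + 1), ξ i ω) ∂μ) := by
  let ε : NNReal := ⟨Real.exp (t * a), (Real.exp_pos _).le⟩
  have hε : (ε : ℝ) = Real.exp (t * a) := rfl
  have hset : {ω | ∃ j ≤ N, a ≤ ∑ i ∈ Finset.range (j + 1), ξ i ω} =
      {ω | (ε : ℝ) ≤ (Finset.range (N + 1)).sup' Finset.nonempty_range_add_one
        fun k => Real.exp (t * ∑ i ∈ Finset.range (k + 1), ξ i ω)} := by
    ext ω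
    simp [Finset.le_sup'_iff, hε, ht]
  have hmax := maximal_ineq (h.submartingale_exp t) (fun n ω => (Real.exp_pos _).le) (ε := ε) N
  rw [← hset] at hmax
  have hint : ∫ ω in {ω | ∃ j ≤ N, a ≤ ∑ i ∈ Finset.range (j + 1), ξ i ω},
      Real.exp (t * ∑ i ∈ Finset.range (N + 1), ξ i ω) ∂μ ≤
      ∫ ω, Real.exp (t * ∑ i ∈ Finset.range (N + 1), ξ i ω) ∂μ :=
    setIntegral_le_integral (h.integrable_exp_sum _ t)
      (ae_of_all _ fun ω => (Real.exp_pos _).le)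
  have hmax' := hmax.trans (ENNReal.ofReal_le_ofReal hint)
  have hε0 : (ε : ENNReal) = ENNReal.ofReal (Real.exp (t * a)) := by
    rw [← hε, ENNReal.ofReal_coe_nnreal]
  rw [Real.exp_neg, mul_comm, ← div_eq_mul_inv, ENNReal.ofReal_div_of_pos (Real.exp_pos _),
    ENNReal.le_div_iff_mul_le (by simp [Real.exp_pos]) (by simp), ← hε0, mul_comm]
  exact hmax'

/-- A Gaussian type lower bound for the upper tail of a sum, valid in the moderate deviation
regime. -/
theorem le_measure_le_sum (h : IsStandardBoundedSeq μ ξ C) (s : Finset ℕ) {t ε L : ℝ}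
    (hε : 0 < ε) (hε1 : ε ≤ 1) (ht : 0 < t) (htC : 2 * t ≤ ε ^ 2 / 8 / (4 * C ^ 3))
    (hL : s.card * t ^ 2 = 2 * L) (hLε : 8 ≤ L * ε ^ 2) :
    Real.exp (-(L * (1 + 3 * ε))) / 2 ≤
      μ.real {ω | (1 - ε) * (s.card * t) ≤ ∑ i ∈ s, ξ i ω} := by
  set S : Ω → ℝ := fun ω => ∑ i ∈ s, ξ i ω with hS
  set V : ℝ := (s.card : ℝ) with hV
  set η := ε ^ 2 / 8 with hη
  have hSm : Measurable S := Finset.measurable_fun_sum _ fun i _ => h.measurable i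
  have hη0 : 0 < η := by positivity
  have hη1 : η ≤ 1 := by rw [hη]; nlinarith
  have hL0 : 0 < L := by
    by_contra hneg
    nlinarith [sq_nonneg ε]
  set A : Set Ω := {ω | (1 - ε) * (V * t) ≤ S ω} with hA
  have hAm : MeasurableSet A := measurableSet_le measurable_const hSm
  have hpt (ω : Ω) : Real.exp (t * S ω) ≤
      Real.exp (t * ((1 + ε) * (V * t))) * A.indicator 1 ω +
        Real.exp (ε * t * ((1 - ε) * (V * t))) * Real.exp ((1 - ε) * t * S ω) +
        Real.exp (-(ε * t * ((1 + ε) * (V * t)))) * Real.exp ((1 + ε) * t * S ω) := by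
    have hεt : 0 < ε * t := mul_pos hε ht
    rw [← Real.exp_add, ← Real.exp_add]
    by_cases hω : ω ∈ A
    · rw [Set.indicator_of_mem hω, Pi.one_apply, mul_one]
      rcases le_total (S ω) ((1 + ε) * (V * t)) with hle | hle
      · have : Real.exp (t * S ω) ≤ Real.exp (t * ((1 + ε) * (V * t))) := by gcongr
        have := Real.exp_pos (ε * t * ((1 - ε) * (V * t)) + (1 - ε) * t * S ω)
        have := Real.exp_pos (-(ε * t * ((1 + ε) * (V * t))) + (1 + ε) * t * S ω)
        linarith
      · have : Real.exp (t * S ω) ≤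
            Real.exp (-(ε * t * ((1 + ε) * (V * t))) + (1 + ε) * t * S ω) := by
          rw [Real.exp_le_exp]; nlinarith
        have := Real.exp_pos (ε * t * ((1 - ε) * (V * t)) + (1 - ε) * t * S ω)
        have := Real.exp_pos (t * ((1 + ε) * (V * t)))
        linarith
    · rw [Set.indicator_of_notMem hω, mul_zero, zero_add]
      have hlt : S ω ≤ (1 - ε) * (V * t) := (not_le.1 hω).le
      have : Real.exp (t * S ω) ≤
          Real.exp (ε * t * ((1 - ε) * (V * t)) + (1 - ε) * t * S ω) := by
        rw [Real.exp_le_exp]; nlinarith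
      have := Real.exp_pos (-(ε * t * ((1 + ε) * (V * t))) + (1 + ε) * t * S ω)
      linarith
  have hi1 : Integrable (fun ω => Real.exp (t * ((1 + ε) * (V * t))) * A.indicator 1 ω) μ :=
    (integrable_indicator_iff hAm |>.2 (integrable_const (1 : ℝ)).integrableOn).const_mul _
  have hi2 := (h.integrable_exp_sum s ((1 - ε) * t)).const_mul
    (Real.exp (ε * t * ((1 - ε) * (V * t))))
  have hi3 := (h.integrable_exp_sum s ((1 + ε) * t)).const_mul
    (Real.exp (-(ε * t * ((1 + ε) * (V * t)))))
  have hI := integral_mono (h.integrable_exp_sum s t) ((hi1.add hi2).add hi3) hpt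
  rw [integral_add' (hi1.add hi2) hi3, integral_add' hi1 hi2, integral_const_mul,
    integral_const_mul, integral_const_mul, integral_indicator_one hAm] at hI
  have habs (r : ℝ) (hr0 : 0 ≤ r) (hr : r ≤ 2) : |r * t| ≤ η / (4 * C ^ 3) := by
    rw [abs_of_nonneg (by positivity)]
    exact le_trans (by gcongr) htC
  have hm1 := (h.mgf_sum_mem_Icc s hη0 hη1 (habs 1 (by norm_num) (by norm_num))).1
  have hm2 := (h.mgf_sum_mem_Icc s hη0 hη1 (habs (1 - ε) (by linarith) (by linarith))).2
  have hm3 := (h.mgf_sum_mem_Icc s hη0 hη1 (habs (1 + ε) (by linarith) (by linarith))).2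
  rw [one_mul, ← hV, show V * (t ^ 2 / 2) = L by linarith] at hm1
  rw [← hV, show V * (((1 - ε) * t) ^ 2 / 2) = L * (1 - ε) ^ 2 by
    linear_combination (1 - ε) ^ 2 / 2 * hL] at hm2
  rw [← hV, show V * (((1 + ε) * t) ^ 2 / 2) = L * (1 + ε) ^ 2 by
    linear_combination (1 + ε) ^ 2 / 2 * hL] at hm3
  rw [show t * ((1 + ε) * (V * t)) = 2 * L * (1 + ε) by linear_combination (1 + ε) * hL,
    show ε * t * ((1 - ε) * (V * t)) = 2 * L * (ε * (1 - ε)) by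
      linear_combination ε * (1 - ε) * hL,
    show ε * t * ((1 + ε) * (V * t)) = 2 * L * (ε * (1 + ε)) by
      linear_combination ε * (1 + ε) * hL] at hI
  have hsmall : Real.exp (L * (1 - ε ^ 2 / 2)) ≤ Real.exp (L * (1 - η)) / 4 := by
    have h4 : (4 : ℝ) ≤ Real.exp 3 := by linarith [Real.add_one_le_exp (3 : ℝ)]
    rw [le_div_iff₀ (by norm_num)]
    calc _ ≤ Real.exp (L * (1 - ε ^ 2 / 2)) * Real.exp 3 := by gcongr
      _ = Real.exp (L * (1 - ε ^ 2 / 2) + 3) := (Real.exp_add _ _).symm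
      _ ≤ _ := by rw [Real.exp_le_exp, hη]; nlinarith
  have hb2 : Real.exp (2 * L * (ε * (1 - ε))) *
      ∫ ω, Real.exp ((1 - ε) * t * ∑ i ∈ s, ξ i ω) ∂μ ≤ Real.exp (L * (1 - η)) / 4 := by
    refine le_trans (mul_le_mul_of_nonneg_left hm2 (Real.exp_pos _).le) (le_trans ?_ hsmall)
    rw [← Real.exp_add, Real.exp_le_exp]
    have h1 : (1 - ε) ^ 2 ≤ 1 := by nlinarith
    have : (1 - ε) ^ 2 * η ≤ ε ^ 2 / 2 := by rw [hη]; nlinarith [sq_nonneg ε]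
    nlinarith
  have hb3 : Real.exp (-(2 * L * (ε * (1 + ε)))) *
      ∫ ω, Real.exp ((1 + ε) * t * ∑ i ∈ s, ξ i ω) ∂μ ≤ Real.exp (L * (1 - η)) / 4 := by
    refine le_trans (mul_le_mul_of_nonneg_left hm3 (Real.exp_pos _).le) (le_trans ?_ hsmall)
    rw [← Real.exp_add, Real.exp_le_exp]
    have h4 : (1 + ε) ^ 2 ≤ 4 := by nlinarith
    have : (1 + ε) ^ 2 * η ≤ ε ^ 2 / 2 := by rw [hη]; nlinarith [sq_nonneg ε]
    nlinarith
  have hmain : Real.exp (L * (1 - η)) / 2 ≤ Real.exp (2 * L * (1 + ε)) * μ.real A := by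
    linarith
  have hfin : Real.exp (-(L * (1 + 3 * ε))) * Real.exp (2 * L * (1 + ε)) ≤
      Real.exp (L * (1 - η)) := by
    rw [← Real.exp_add, Real.exp_le_exp]
    have : η ≤ ε := by rw [hη]; nlinarith
    nlinarith
  have hpos := Real.exp_pos (2 * L * (1 + ε))
  refine le_of_mul_le_mul_left ?_ hpos
  linarith

end IsStandardBoundedSeq

/-- The normalization `√(2 x log log x)` of the law of the iterated logarithm. -/
def lilScale (x : ℝ) : ℝ := Real.sqrt (2 * x * Real.log (Real.log x))

theorem lilScale_le_lilScale {x y : ℝ} (hx : Real.exp 1 ≤ x) (hxy : x ≤ y) :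
    lilScale x ≤ lilScale y := by
  have hx0 : 0 < x := (Real.exp_pos 1).trans_le hx
  have hlog : 1 ≤ Real.log x := (Real.le_log_iff_exp_le hx0).2 hx
  have : 0 ≤ Real.log (Real.log x) := Real.log_nonneg hlog
  unfold lilScale
  have : 0 ≤ 2 * y := by linarith
  gcongr

theorem tendsto_log_log_atTop : Tendsto (fun x : ℝ => Real.log (Real.log x)) atTop atTop :=
  Real.tendsto_log_atTop.comp Real.tendsto_log_atTop

theorem tendsto_lilScale_atTop : Tendsto lilScale atTop atTop :=
  Real.tendsto_sqrt_atTop.comp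
    ((tendsto_id.const_mul_atTop two_pos).atTop_mul_atTop₀ tendsto_log_log_atTop)

theorem sq_lilScale {x : ℝ} (hx : Real.exp 1 ≤ x) :
    lilScale x ^ 2 = 2 * x * Real.log (Real.log x) := by
  have hx0 : 0 < x := (Real.exp_pos 1).trans_le hx
  have : 0 ≤ Real.log (Real.log x) :=
    Real.log_nonneg ((Real.le_log_iff_exp_le hx0).2 hx)
  exact Real.sq_sqrt (by positivity)

theorem tendsto_log_log_div_atTop :
    Tendsto (fun x : ℝ => Real.log (Real.log x) / x) atTop (𝓝 0) := by
  refine squeeze_zero' ?_ ?_ (Real.isLittleO_log_id_atTop.tendsto_div_nhds_zero)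
  · filter_upwards [tendsto_log_log_atTop.eventually_ge_atTop 0, eventually_ge_atTop 0] with x h h0
    positivity
  · filter_upwards [Real.tendsto_log_atTop.eventually_ge_atTop 0, eventually_gt_atTop 0]
      with x h h0
    have := Real.log_le_self h
    simp only [id]
    gcongr

theorem tendsto_lilScale_div_atTop : Tendsto (fun x => lilScale x / x) atTop (𝓝 0) := by
  have h : Tendsto (fun x : ℝ => Real.sqrt (2 * (Real.log (Real.log x) / x))) atTop (𝓝 0) := by
    simpa using (tendsto_log_log_div_atTop.const_mul 2).sqrt
  refine h.congr' ?_
  filter_upwards [eventually_gt_atTop 0] with x hx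
  rw [lilScale, eq_div_iff hx.ne']
  calc _ = Real.sqrt (2 * (Real.log (Real.log x) / x)) * Real.sqrt (x ^ 2) := by
        rw [Real.sqrt_sq hx.le]
    _ = _ := by
        rw [← Real.sqrt_mul' _ (sq_nonneg x)]
        congr 1
        field_simp

namespace IsStandardBoundedSeq

variable {Ω : Type*} [MeasurableSpace Ω] {μ : Measure Ω} {ξ : ℕ → Ω → ℝ} {C : ℝ}
variable [IsProbabilityMeasure μ]

/-- Upper tail bound along the geometric scale `(1 + ε / 2) ^ k`. -/
theorem measureReal_exists_lilScale_le_sum_le (h : IsStandardBoundedSeq μ ξ C) {ε x : ℝ}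
    (hε : 0 < ε) (hε1 : ε ≤ 1) (hx : Real.exp (Real.exp 1) ≤ x)
    (hxC : (1 + ε) * (lilScale x / x) ≤ ε / 4 / (4 * C ^ 3)) (N : ℕ)
    (hN : (N + 1 : ℝ) ≤ x * (1 + ε / 2)) :
    μ.real {ω | ∃ j ≤ N, (1 + ε) * lilScale x ≤ ∑ i ∈ Finset.range (j + 1), ξ i ω} ≤
      Real.log x ^ (-(1 + ε)) := by
  have hx0 : 0 < x := (Real.exp_pos _).trans_le hx
  have hlog : Real.exp 1 ≤ Real.log x := (Real.le_log_iff_exp_le hx0).2 hx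
  have hlog0 : 0 < Real.log x := (Real.exp_pos 1).trans_le hlog
  have hll : 1 ≤ Real.log (Real.log x) := (Real.le_log_iff_exp_le hlog0).2 hlog
  have hex : Real.exp 1 ≤ x :=
    le_trans (Real.exp_le_exp.2 (by linarith [Real.add_one_le_exp (1 : ℝ)])) hx
  have hsq := sq_lilScale hex
  have hs0 : 0 < lilScale x := Real.sqrt_pos.2 (by positivity)
  set θ := 1 + ε / 2 with hθ
  set a := (1 + ε) * lilScale x with ha
  have ha0 : 0 < a := by positivity
  set t := a / (x * θ) with ht
  have hθ1 : 1 ≤ θ := by rw [hθ]; linarith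
  have ht0 : 0 < t := by positivity
  have htC : |t| ≤ ε / 4 / (4 * C ^ 3) := by
    rw [abs_of_pos ht0]
    refine le_trans ?_ hxC
    rw [ht, ha, ← mul_div_assoc]
    gcongr
    nlinarith
  have hmax := h.measure_exists_le_sum_le ht0 a N
  have hmgf := (h.mgf_sum_mem_Icc (Finset.range (N + 1)) (η := ε / 4) (by positivity)
    (by linarith) htC).2
  rw [measureReal_def]
  refine ENNReal.toReal_le_of_le_ofReal (by positivity) (hmax.trans (ENNReal.ofReal_le_ofReal ?_))
  refine (mul_le_mul_of_nonneg_left hmgf (Real.exp_pos _).le).trans ?_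
  rw [← Real.exp_add, Real.rpow_def_of_pos hlog0, Real.exp_le_exp, Finset.card_range]
  push_cast
  have hta : t * (x * θ) = a := by rw [ht]; field_simp
  have htt : t ^ 2 * (x * θ) = t * a := by rw [sq, mul_assoc, hta]
  have h1 : (N + 1 : ℝ) * (t ^ 2 / 2) * (1 + ε / 4) ≤ t * a / 2 * (1 + ε / 4) := by
    have : (N + 1 : ℝ) * t ^ 2 ≤ t ^ 2 * (x * θ) := by nlinarith [sq_nonneg t]
    rw [htt] at this
    nlinarith
  have h2 : θ * (t * a) = (1 + ε) ^ 2 * (2 * Real.log (Real.log x)) := by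
    have : x * (θ * (t * a)) = x * ((1 + ε) ^ 2 * (2 * Real.log (Real.log x))) := by
      calc x * (θ * (t * a)) = a * (t * (x * θ)) := by ring
        _ = a ^ 2 := by rw [hta]; ring
        _ = (1 + ε) ^ 2 * lilScale x ^ 2 := by rw [ha]; ring
        _ = _ := by rw [hsq]; ring
    exact mul_left_cancel₀ hx0.ne' this
  have h3 : (1 + ε) * Real.log (Real.log x) ≤ t * a / 2 * (1 - ε / 4) := by
    refine le_of_mul_le_mul_left ?_ (zero_lt_one.trans_le hθ1)
    have h4 : θ ≤ (1 + ε) * (1 - ε / 4) := by rw [hθ]; nlinarith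
    calc θ * ((1 + ε) * Real.log (Real.log x))
        ≤ (1 + ε) * (1 - ε / 4) * ((1 + ε) * Real.log (Real.log x)) := by gcongr
      _ = θ * (t * a) / 2 * (1 - ε / 4) := by rw [h2]; ring
      _ = _ := by ring
  nlinarith

theorem ae_eventually_sum_le (h : IsStandardBoundedSeq μ ξ C) {ε : ℝ} (hε : 0 < ε)
    (hε1 : ε ≤ 1) :
    ∀ᵐ ω ∂μ, ∀ᶠ n : ℕ in atTop, ∑ i ∈ Finset.range n, ξ i ω ≤ (1 + ε) * lilScale n := by
  set θ : ℝ := 1 + ε / 2 with hθ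
  have hθ1 : 1 < θ := by rw [hθ]; linarith
  have hpow : Tendsto (fun k : ℕ => θ ^ k) atTop atTop := tendsto_pow_atTop_atTop_of_one_lt hθ1
  let E (k : ℕ) : Set Ω := {ω | ∃ j ≤ ⌊θ ^ (k + 1)⌋₊ - 1,
    (1 + ε) * lilScale (θ ^ k) ≤ ∑ i ∈ Finset.range (j + 1), ξ i ω}
  have hC : 0 < ε / 4 / (4 * C ^ 3) := by have := h.one_le; positivity
  have hbound : ∀ᶠ k : ℕ in atTop, ‖μ.real (E k)‖ ≤ ((k : ℝ) * Real.log θ) ^ (-(1 + ε)) := by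
    have hlim : Tendsto (fun k : ℕ => (1 + ε) * (lilScale (θ ^ k) / θ ^ k)) atTop (𝓝 0) := by
      simpa using (tendsto_lilScale_div_atTop.comp hpow).const_mul (1 + ε)
    filter_upwards [hpow.eventually_ge_atTop (Real.exp (Real.exp 1)),
      hlim.eventually (ge_mem_nhds hC)] with k hk hkC
    rw [Real.norm_of_nonneg measureReal_nonneg, ← Real.log_pow]
    refine h.measureReal_exists_lilScale_le_sum_le hε hε1 hk hkC _ ?_
    have h1 : 1 ≤ ⌊θ ^ (k + 1)⌋₊ := Nat.one_le_floor_iff _ |>.2 (one_le_pow₀ hθ1.le)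
    rw [← pow_succ]
    have := Nat.floor_le (show 0 ≤ θ ^ (k + 1) by positivity)
    push_cast [h1]
    linarith
  have hsum : Summable fun k => μ.real (E k) := by
    refine Summable.of_norm_bounded_eventually_nat (g := fun k : ℕ =>
      ((k : ℝ) * Real.log θ) ^ (-(1 + ε))) ?_ hbound
    have : (fun k : ℕ => ((k : ℝ) * Real.log θ) ^ (-(1 + ε))) =
        fun k : ℕ => (k : ℝ) ^ (-(1 + ε)) * Real.log θ ^ (-(1 + ε)) := by
      ext k
      exact Real.mul_rpow (Nat.cast_nonneg k) (Real.log_nonneg hθ1.le)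
    rw [this]
    exact (Real.summable_nat_rpow.2 (by linarith)).mul_right _
  have htop : ∑' k, μ (E k) ≠ ⊤ := by
    have := hsum.tsum_ofReal_ne_top
    simpa [measureReal_def] using this
  filter_upwards [ae_eventually_notMem htop] with ω hω
  obtain ⟨K, hK⟩ := eventually_atTop.1
    (hω.and (hpow.eventually_ge_atTop (Real.exp 1)))
  filter_upwards [eventually_ge_atTop 1, eventually_ge_atTop ⌈θ ^ K⌉₊] with n hn1 hnK
  obtain ⟨k, hk1, hk2⟩ := exists_nat_pow_near (x := (n : ℝ)) (by exact_mod_cast hn1) hθ1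
  have hKk : K ≤ k := by
    have : θ ^ K < θ ^ (k + 1) := (Nat.ceil_le.1 hnK).trans_lt hk2
    exact Nat.lt_succ_iff.1 ((pow_lt_pow_iff_right₀ hθ1).1 this)
  obtain ⟨hnot, hexp⟩ := hK k hKk
  have hlt : ∑ i ∈ Finset.range n, ξ i ω < (1 + ε) * lilScale (θ ^ k) := by
    by_contra hcon
    refine hnot ⟨n - 1, ?_, ?_⟩
    · exact Nat.sub_le_sub_right (Nat.le_floor hk2.le) 1
    · rw [Nat.sub_add_cancel hn1]
      exact not_lt.1 hcon
  refine hlt.le.trans ?_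
  gcongr
  exact lilScale_le_lilScale hexp hk1

end IsStandardBoundedSeq

/-- A sequence of σ-algebras is independent as soon as each one is independent of the join of
its predecessors. -/
theorem iIndep_of_indep_iSup_lt {Ω : Type*} {mΩ : MeasurableSpace Ω} {μ : Measure Ω}
    [IsProbabilityMeasure μ] {m : ℕ → MeasurableSpace Ω}
    (h : ∀ n, Indep (⨆ k < n, m k) (m n) μ) : iIndep m μ := by
  rw [iIndep_iff]
  intro s
  induction s using Finset.induction_on_max with
  | empty => simp
  | insert a s hs ih =>
    intro f hf
    have ha : a ∉ s := fun h => lt_irrefl _ (hs a h)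
    rw [Finset.prod_insert ha, Finset.set_biInter_insert, Set.inter_comm, mul_comm,
      ← ih fun i hi => hf i (Finset.mem_insert_of_mem hi)]
    refine (Indep_iff _ _ _).1 (h a) _ _ ?_ (hf a (Finset.mem_insert_self a s))
    refine MeasurableSet.biInter s.countable_toSet fun i hi => ?_
    exact le_iSup₂ (f := fun k (_ : k < a) => m k) i (hs i hi) _
      (hf i (Finset.mem_insert_of_mem hi))

namespace IsStandardBoundedSeq

variable {Ω : Type*} [MeasurableSpace Ω] {μ : Measure Ω} {ξ : ℕ → Ω → ℝ} {C : ℝ}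

theorem measurableSet_le_sum (h : IsStandardBoundedSeq μ ξ C) (s : Finset ℕ) (a : ℝ) :
    MeasurableSet {ω | a ≤ ∑ i ∈ s, ξ i ω} :=
  measurableSet_le measurable_const (Finset.measurable_fun_sum _ fun i _ => h.measurable i)

variable [IsProbabilityMeasure μ]

theorem iIndepSet_le_sum_Ico (h : IsStandardBoundedSeq μ ξ C) {u : ℕ → ℕ} (hu : Monotone u)
    (a : ℕ → ℝ) :
    iIndepSet (fun k => {ω | a k ≤ ∑ i ∈ Finset.Ico (u k) (u (k + 1)), ξ i ω}) μ := by
  have hgen (k : ℕ) (S : Set ℕ) (hS : ∀ i ∈ Finset.Ico (u k) (u (k + 1)), i ∈ S) :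
      MeasurableSpace.generateFrom {{ω | a k ≤ ∑ i ∈ Finset.Ico (u k) (u (k + 1)), ξ i ω}} ≤
        ⨆ i ∈ S, MeasurableSpace.comap (ξ i) inferInstance := by
    refine MeasurableSpace.generateFrom_le fun s hs => ?_
    rw [Set.mem_singleton_iff.1 hs]
    refine @measurableSet_le _ _ _ _ _ (⨆ i ∈ S, MeasurableSpace.comap (ξ i) inferInstance)
      _ _ _ _ _ measurable_const (Finset.measurable_fun_sum _ fun i hi => ?_)
    exact (comap_measurable (ξ i)).mono
      (le_iSup₂ (f := fun i (_ : i ∈ S) => MeasurableSpace.comap (ξ i) inferInstance) i (hS i hi))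
      le_rfl
  rw [iIndepSet_iff_iIndep]
  refine iIndep_of_indep_iSup_lt fun n => ?_
  have hdisj : Disjoint (Set.Iio (u n)) (Set.Ici (u n)) := by
    rw [Set.disjoint_left]
    intro x hx hx'
    exact absurd (Set.mem_Iio.1 hx) (not_lt.2 hx')
  have hind := indep_iSup_of_disjoint (fun i => (h.measurable i).comap_le) h.indep hdisj
  refine indep_of_indep_of_le_left (indep_of_indep_of_le_right hind (hgen n _ fun i hi => ?_))
    (iSup₂_le fun k hk => hgen k _ fun i hi => ?_)
  · exact (Finset.mem_Ico.1 hi).1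
  · exact (Finset.mem_Ico.1 hi).2.trans_le (hu hk)

theorem ae_frequently_le_sum_Ico (h : IsStandardBoundedSeq μ ξ C) {θ : ℕ} (hθ : 2 ≤ θ)
    {ε : ℝ} (hε : 0 < ε) (hε1 : ε ≤ 1) :
    ∀ᵐ ω ∂μ, ∃ᶠ k : ℕ in atTop,
      (1 - ε) * Real.sqrt (2 * (θ ^ k * (θ - 1)) * (Real.log k / (1 + 3 * ε))) ≤
        ∑ i ∈ Finset.Ico (θ ^ k) (θ ^ (k + 1)), ξ i ω := by
  have hθ' : (2 : ℝ) ≤ θ := by exact_mod_cast hθ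
  set a : ℕ → ℝ := fun k =>
    (1 - ε) * Real.sqrt (2 * (θ ^ k * (θ - 1)) * (Real.log k / (1 + 3 * ε)))
  set F : ℕ → Set Ω := fun k => {ω | a k ≤ ∑ i ∈ Finset.Ico (θ ^ k) (θ ^ (k + 1)), ξ i ω} with hF
  have hFm k : MeasurableSet (F k) := h.measurableSet_le_sum _ _
  have hFind : iIndepSet F μ :=
    h.iIndepSet_le_sum_Ico (u := fun k => θ ^ k)
      (fun i j hij => Nat.pow_le_pow_right (by omega) hij) a
  have hlog : Tendsto (fun k : ℕ => Real.log k) atTop atTop :=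
    Real.tendsto_log_atTop.comp tendsto_natCast_atTop_atTop
  have hpow : Tendsto (fun k : ℕ => (θ : ℝ) ^ k) atTop atTop :=
    tendsto_pow_atTop_atTop_of_one_lt (by linarith)
  have hc : 0 < ε ^ 2 / 8 / (4 * C ^ 3) := by have := h.one_le; positivity
  have hlim : Tendsto (fun k : ℕ => 2 * Real.sqrt (2 * ((k : ℝ) ^ 1 / (θ : ℝ) ^ k)))
      atTop (𝓝 0) := by
    simpa using (((tendsto_pow_const_div_const_pow_of_one_lt 1
      (show (1 : ℝ) < θ by linarith)).const_mul 2).sqrt).const_mul 2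
  have hprob : ∀ᶠ k : ℕ in atTop, ‖((k : ℝ))⁻¹‖ ≤ 2 * μ.real (F k) := by
    filter_upwards [hlog.eventually_ge_atTop (8 / ε ^ 2 * (1 + 3 * ε)), eventually_ge_atTop 1,
      hlim.eventually (ge_mem_nhds hc)] with k hk hk1 hkt
    have hk0 : (0 : ℝ) < k := by exact_mod_cast hk1
    set L := Real.log k / (1 + 3 * ε) with hLdef
    have hLε : 8 ≤ L * ε ^ 2 := by
      rw [← div_le_iff₀ (by positivity), hLdef, le_div_iff₀ (by positivity)]
      exact hk
    have hL0 : 0 < L := by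
      by_contra hneg
      nlinarith [sq_nonneg ε]
    have hcard : ((Finset.Ico (θ ^ k) (θ ^ (k + 1))).card : ℝ) = θ ^ k * (θ - 1) := by
      rw [Nat.card_Ico, Nat.cast_sub (Nat.pow_le_pow_right (by omega) (by omega : k ≤ k + 1))]
      push_cast
      ring
    set V : ℝ := θ ^ k * (θ - 1) with hV
    have hVge : (θ : ℝ) ^ k ≤ V := le_mul_of_one_le_right (by positivity) (by linarith)
    have hV0 : 0 < V := lt_of_lt_of_le (by positivity) hVge
    set t := Real.sqrt (2 * (L / V)) with ht
    have ht0 : 0 < t := Real.sqrt_pos.2 (by positivity)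
    have htsq : t ^ 2 = 2 * (L / V) := Real.sq_sqrt (by positivity)
    have hVt : V * t = Real.sqrt (2 * V * L) := by
      rw [eq_comm, Real.sqrt_eq_iff_eq_sq (by positivity) (by positivity), mul_pow, htsq]
      field_simp
    have hLk : L ≤ k ^ 1 := by
      rw [pow_one]
      refine le_trans (div_le_self (Real.log_nonneg (by exact_mod_cast hk1)) (by linarith)) ?_
      exact Real.log_le_self hk0.le
    have htC : 2 * t ≤ ε ^ 2 / 8 / (4 * C ^ 3) := by
      refine le_trans ?_ hkt
      rw [ht]
      gcongr
    have hmain := h.le_measure_le_sum (Finset.Ico (θ ^ k) (θ ^ (k + 1))) hε hε1 ht0 htC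
      (L := L) (by rw [hcard, htsq]; field_simp) hLε
    rw [hcard, hVt, show L * (1 + 3 * ε) = Real.log k by rw [hLdef]; field_simp,
      Real.exp_neg, Real.exp_log hk0] at hmain
    rw [Real.norm_of_nonneg (by positivity)]
    simp only [hF, a]
    linarith
  have htop : ∑' k, μ (F k) = ⊤ := by
    by_contra hne
    have hs : Summable fun k => 2 * μ.real (F k) :=
      (ENNReal.summable_toReal hne).mul_left 2
    exact Real.not_summable_natCast_inv (Summable.of_norm_bounded_eventually_nat hs hprob)
  have hone := measure_limsup_eq_one hFm hFind htop
  have hae : ∀ᵐ ω ∂μ, ω ∈ limsup F atTop :=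
    (prob_compl_eq_zero_iff (MeasurableSet.measurableSet_limsup hFm)).2 hone
  filter_upwards [hae] with ω hω
  rwa [mem_limsup_iff_frequently_mem] at hω

theorem ae_frequently_le_sum_of_eq_one_div (h : IsStandardBoundedSeq μ ξ C) {K : ℕ} (hK : 2 ≤ K)
    {ε : ℝ} (hε : ε = 1 / K) :
    ∀ᵐ ω ∂μ, ∃ᶠ n : ℕ in atTop,
      ((1 - ε) * Real.sqrt ((1 - ε) * (1 - ε ^ 2) / (1 + 3 * ε)) - 2 * ε) * lilScale n ≤
        ∑ i ∈ Finset.range n, ξ i ω := by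
  have hK' : (2 : ℝ) ≤ K := by exact_mod_cast hK
  have hε0 : 0 < ε := by rw [hε]; positivity
  have hεK : ε * K = 1 := by rw [hε]; field_simp
  have hε1 : ε ≤ 1 := by nlinarith
  have hθ : 2 ≤ K ^ 2 := by nlinarith
  have hθ' : (1 : ℝ) < (K : ℝ) ^ 2 := by nlinarith
  have hlogθ : 0 < Real.log ((K : ℝ) ^ 2) := Real.log_pos hθ'
  have hlog : Tendsto (fun k : ℕ => Real.log k) atTop atTop :=
    Real.tendsto_log_atTop.comp tendsto_natCast_atTop_atTop
  have hpowN : Tendsto (fun k : ℕ => (K ^ 2) ^ k) atTop atTop :=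
    tendsto_pow_atTop_atTop_of_one_lt (by omega)
  have hpow : Tendsto (fun k : ℕ => ((K : ℝ) ^ 2) ^ k) atTop atTop :=
    tendsto_pow_atTop_atTop_of_one_lt hθ'
  filter_upwards [h.ae_frequently_le_sum_Ico hθ hε0 hε1,
    h.neg.ae_eventually_sum_le one_pos le_rfl] with ω hfreq hev
  have hsucc : Tendsto (fun k : ℕ => (K ^ 2) ^ (k + 1)) atTop atTop :=
    hpowN.comp (tendsto_add_atTop_nat 1)
  refine hsucc.frequently ?_
  refine (hfreq.and_eventually ((hpowN.eventually hev).and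
    ((hpow.eventually_ge_atTop (Real.exp 1)).and
    ((hlog.eventually_ge_atTop ((1 - ε) * (Real.log 2 + Real.log (Real.log ((K : ℝ) ^ 2))) / ε)).and
    (eventually_ge_atTop 1))))).mono ?_
  rintro k ⟨hD, hT, hexp, hlogk, hk1⟩
  rw [Finset.range_eq_Ico, ← Finset.sum_Ico_consecutive _ (Nat.zero_le _)
    (Nat.pow_le_pow_right (show 0 < K ^ 2 by omega) (Nat.le_succ k)), ← Finset.range_eq_Ico]
  rw [Finset.sum_neg_distrib] at hT
  push_cast at hD hT ⊢
  set x : ℝ := ((K : ℝ) ^ 2) ^ k with hx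
  have hy : ((K : ℝ) ^ 2) ^ (k + 1) = K ^ 2 * x := by rw [hx, pow_succ]; ring
  have hx0 : 0 < x := (Real.exp_pos 1).trans_le hexp
  have hxy : x ≤ K ^ 2 * x := le_mul_of_one_le_left hx0.le hθ'.le
  have hllx : 0 ≤ Real.log (Real.log x) :=
    Real.log_nonneg ((Real.le_log_iff_exp_le hx0).2 hexp)
  have hlly : Real.log (Real.log x) ≤ Real.log (Real.log (K ^ 2 * x)) := by
    have := (Real.le_log_iff_exp_le hx0).2 hexp
    gcongr
  have hk0 : (0 : ℝ) < k := by exact_mod_cast hk1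
  rw [hy]
  set ly := Real.log (Real.log (K ^ 2 * x)) with hly
  have hlyk : (1 - ε) * ly ≤ Real.log k := by
    have h1 : ly ≤ Real.log k + (Real.log 2 + Real.log (Real.log ((K : ℝ) ^ 2))) := by
      rw [hly, ← hy, Real.log_pow, ← Real.log_mul (by norm_num) hlogθ.ne',
        ← Real.log_mul hk0.ne' (by positivity)]
      apply Real.log_le_log (by positivity)
      have : ((k + 1 : ℕ) : ℝ) ≤ 2 * k := by
        have : (1 : ℝ) ≤ k := by exact_mod_cast hk1
        push_cast; linarith
      calc _ ≤ 2 * k * Real.log ((K : ℝ) ^ 2) := by gcongr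
        _ = _ := by ring
    rw [div_le_iff₀ hε0] at hlogk
    nlinarith
  have hscale : lilScale x ≤ ε * lilScale (K ^ 2 * x) := by
    unfold lilScale
    rw [← Real.sqrt_sq hε0.le, ← Real.sqrt_mul (sq_nonneg ε)]
    apply Real.sqrt_le_sqrt
    calc 2 * x * Real.log (Real.log x) ≤ 2 * x * ly := by gcongr
      _ = (ε * K) ^ 2 * (2 * x * ly) := by rw [hεK]; ring
      _ = _ := by ring
  have hblock : Real.sqrt ((1 - ε) * (1 - ε ^ 2) / (1 + 3 * ε)) * lilScale (K ^ 2 * x) ≤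
      Real.sqrt (2 * (x * ((K : ℝ) ^ 2 - 1)) * (Real.log k / (1 + 3 * ε))) := by
    have hq : 0 ≤ (1 - ε) * (1 - ε ^ 2) / (1 + 3 * ε) := by
      have : ε ^ 2 ≤ 1 := by nlinarith
      have := mul_nonneg (sub_nonneg.2 hε1) (sub_nonneg.2 this)
      positivity
    unfold lilScale
    rw [← Real.sqrt_mul hq]
    apply Real.sqrt_le_sqrt
    calc _ = 2 * (x * (K ^ 2 - (ε * K) ^ 2)) * ((1 - ε) * ly / (1 + 3 * ε)) := by ring
      _ = 2 * (x * (K ^ 2 - 1)) * ((1 - ε) * ly / (1 + 3 * ε)) := by rw [hεK]; ring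
      _ ≤ _ := by
        have : 0 ≤ (K : ℝ) ^ 2 - 1 := by linarith
        gcongr
  have := mul_le_mul_of_nonneg_left hblock (sub_nonneg.2 hε1)
  linarith

theorem ae_frequently_le_sum (h : IsStandardBoundedSeq μ ξ C) {r : ℝ} (hr : r < 1) :
    ∀ᵐ ω ∂μ, ∃ᶠ n : ℕ in atTop, r * lilScale n ≤ ∑ i ∈ Finset.range n, ξ i ω := by
  have hcont : ContinuousAt (fun ε : ℝ =>
      (1 - ε) * Real.sqrt ((1 - ε) * (1 - ε ^ 2) / (1 + 3 * ε)) - 2 * ε) 0 := by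
    have : ContinuousAt (fun ε : ℝ => (1 - ε) * (1 - ε ^ 2) / (1 + 3 * ε)) 0 :=
      ContinuousAt.div (by fun_prop) (by fun_prop) (by norm_num)
    exact (ContinuousAt.mul (by fun_prop) this.sqrt).sub (by fun_prop)
  have hlim := hcont.tendsto.comp tendsto_one_div_atTop_nhds_zero_nat
  simp only [sub_zero, ne_eq, OfNat.ofNat_ne_zero, not_false_eq_true, zero_pow, mul_zero, add_zero,
    mul_one, div_one, Real.sqrt_one] at hlim
  obtain ⟨K, hK2, hK⟩ := ((eventually_ge_atTop 2).and (hlim.eventually (lt_mem_nhds hr))).exists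
  filter_upwards [h.ae_frequently_le_sum_of_eq_one_div hK2 rfl] with ω hω
  refine hω.mono fun n hn => le_trans ?_ hn
  exact mul_le_mul_of_nonneg_right hK.le (Real.sqrt_nonneg _)

end IsStandardBoundedSeq

section SignVariables

variable {Ω : Type*} {mΩ : MeasurableSpace Ω} {μ : Measure Ω}

theorem integrable_of_ae_eq_one_or_neg_one [IsFiniteMeasure μ] {Z : Ω → ℝ} (hZ : Measurable Z)
    (hval : ∀ᵐ ω ∂μ, Z ω = 1 ∨ Z ω = -1) : Integrable Z μ := by
  refine Integrable.of_bound hZ.aestronglyMeasurable 1 (hval.mono fun ω hω => ?_)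
  rcases hω with hω | hω <;> simp [hω]

/-- The law of a `±1`-valued variable on an event is determined by its mean on that event. -/
theorem measureReal_inter_preimage_of_setIntegral_eq [IsFiniteMeasure μ] {Z : Ω → ℝ}
    (hZ : Measurable Z) (hval : ∀ᵐ ω ∂μ, Z ω = 1 ∨ Z ω = -1) {q : ℝ} {A : Set Ω}
    (hq : ∫ ω in A, Z ω ∂μ = μ.real A * q) {B : Set ℝ}
    (hB : MeasurableSet B) :
    μ.real (A ∩ Z ⁻¹' B) =
      μ.real A * ((B.indicator 1 (1 : ℝ) + B.indicator 1 (-1 : ℝ)) / 2 +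
        (B.indicator 1 (1 : ℝ) - B.indicator 1 (-1 : ℝ)) / 2 * q) := by
  set a : ℝ := B.indicator 1 (1 : ℝ)
  set b : ℝ := B.indicator 1 (-1 : ℝ)
  have hae : ∀ᵐ ω ∂μ.restrict A,
      (Z ⁻¹' B).indicator (1 : Ω → ℝ) ω = (a + b) / 2 + (a - b) / 2 * Z ω := by
    filter_upwards [ae_restrict_of_ae hval] with ω hω
    have : (Z ⁻¹' B).indicator (1 : Ω → ℝ) ω = B.indicator 1 (Z ω) := by
      rfl
    rw [this]
    rcases hω with hω | hω <;> rw [hω] <;> ring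
  have hint := (integrable_of_ae_eq_one_or_neg_one hZ hval).restrict (s := A)
  calc μ.real (A ∩ Z ⁻¹' B) = ∫ ω in A, (Z ⁻¹' B).indicator (1 : Ω → ℝ) ω ∂μ := by
        rw [integral_indicator_one (hZ hB), measureReal_restrict_apply (hZ hB), Set.inter_comm]
    _ = ∫ ω in A, ((a + b) / 2 + (a - b) / 2 * Z ω) ∂μ := integral_congr_ae hae
    _ = _ := by
        rw [integral_add (integrable_const _) (hint.const_mul _), integral_const_mul, hq]
        simp
        ring

theorem indep_comap_of_condExp_eq_const {m mΩ : MeasurableSpace Ω} {μ : Measure Ω}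
    [IsProbabilityMeasure μ] (hm : m ≤ mΩ) {Z : Ω → ℝ} (hZ : Measurable Z)
    (hval : ∀ᵐ ω ∂μ, Z ω = 1 ∨ Z ω = -1) {q : ℝ} (hc : μ[Z | m] =ᵐ[μ] fun _ => q) :
    Indep m (MeasurableSpace.comap Z inferInstance) μ := by
  rw [Indep_iff]
  rintro A _ hA ⟨B, hB, rfl⟩
  have hint (A : Set Ω) (hA : MeasurableSet[m] A) : ∫ ω in A, Z ω ∂μ = μ.real A * q := by
    rw [← setIntegral_condExp hm (integrable_of_ae_eq_one_or_neg_one hZ hval) hA,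
      setIntegral_congr_ae (hm A hA) (hc.mono fun ω h _ => h)]
    simp
  have h1 := measureReal_inter_preimage_of_setIntegral_eq hZ hval (hint A hA) hB
  have h2 := measureReal_inter_preimage_of_setIntegral_eq hZ hval
    (hint _ MeasurableSet.univ) hB
  rw [Set.univ_inter, probReal_univ, one_mul] at h2
  rw [← h2] at h1
  rw [← ENNReal.toReal_eq_toReal_iff' (measure_ne_top _ _) (by finiteness), ENNReal.toReal_mul]
  exact h1

theorem identDistrib_of_ae_eq_one_or_neg_one [IsProbabilityMeasure μ] {Z Z' : Ω → ℝ}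
    (hZ : Measurable Z) (hZ' : Measurable Z')
    (hval : ∀ᵐ ω ∂μ, Z ω = 1 ∨ Z ω = -1) (hval' : ∀ᵐ ω ∂μ, Z' ω = 1 ∨ Z' ω = -1)
    (hmean : ∫ ω, Z ω ∂μ = ∫ ω, Z' ω ∂μ) : IdentDistrib Z Z' μ μ := by
  refine ⟨hZ.aemeasurable, hZ'.aemeasurable, Measure.ext fun B hB => ?_⟩
  have h1 := measureReal_inter_preimage_of_setIntegral_eq hZ hval
    (A := Set.univ) (q := ∫ ω, Z ω ∂μ) (by simp) hB
  have h2 := measureReal_inter_preimage_of_setIntegral_eq hZ' hval'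
    (A := Set.univ) (q := ∫ ω, Z ω ∂μ) (by simp [hmean]) hB
  rw [← h2, Set.univ_inter, Set.univ_inter] at h1
  rw [Measure.map_apply hZ hB, Measure.map_apply hZ' hB]
  exact (ENNReal.toReal_eq_toReal_iff' (measure_ne_top _ _) (measure_ne_top _ _)).1 h1

end SignVariables

/-- The first step of the walk, followed by the later steps relative to the first one. -/
def relativeStep {Ω : Type*} (X : ℕ → Ω → ℝ) (k : ℕ) (ω : Ω) : ℝ :=
  if k = 0 then X 1 ω else X (k + 1) ω * X 1 ω

section RelativeStep

variable {Ω : Type*} {X : ℕ → Ω → ℝ}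

theorem measurable_sigmaUpTo {i n : ℕ} (hi : 1 ≤ i) (hin : i ≤ n) :
    Measurable[sigmaUpTo X n] (X i) :=
  (comap_measurable (X i)).mono
    (le_iSup₂ (f := fun i (_ : i ∈ Finset.Icc 1 n) => MeasurableSpace.comap (X i) inferInstance) i
      (Finset.mem_Icc.2 ⟨hi, hin⟩)) le_rfl

theorem comap_relativeStep_le {k n : ℕ} (hkn : k < n) :
    MeasurableSpace.comap (relativeStep X k) inferInstance ≤ sigmaUpTo X n := by
  rw [← measurable_iff_comap_le]
  unfold relativeStep
  split_ifs
  · exact measurable_sigmaUpTo le_rfl (by omega)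
  · exact (measurable_sigmaUpTo (by omega) (by omega)).mul
      (measurable_sigmaUpTo le_rfl (by omega))

variable [MeasurableSpace Ω] {μ : Measure Ω}

theorem measurable_relativeStep (hX : ∀ i, Measurable (X i)) (k : ℕ) :
    Measurable (relativeStep X k) := by
  unfold relativeStep
  split_ifs
  · exact hX 1
  · exact (hX _).mul (hX 1)

theorem relativeStep_eq_one_or_neg_one (hval : ∀ i, 1 ≤ i → ∀ᵐ ω ∂μ, X i ω = 1 ∨ X i ω = -1)
    (k : ℕ) : ∀ᵐ ω ∂μ, relativeStep X k ω = 1 ∨ relativeStep X k ω = -1 := by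
  filter_upwards [hval 1 le_rfl, hval (k + 1) (by omega)] with ω h1 hk
  unfold relativeStep
  split_ifs
  · exact h1
  · rcases h1 with h1 | h1 <;> rcases hk with hk | hk <;> simp [h1, hk]

theorem sigmaUpTo_le (hX : ∀ i, Measurable (X i)) (n : ℕ) :
    sigmaUpTo X n ≤ ‹MeasurableSpace Ω› :=
  iSup₂_le fun i _ => (hX i).comap_le

variable [IsProbabilityMeasure μ] {q : ℝ}

theorem condExp_relativeStep (hX : ∀ i, Measurable (X i))
    (hval : ∀ i, 1 ≤ i → ∀ᵐ ω ∂μ, X i ω = 1 ∨ X i ω = -1)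
    (hcond : ∀ n, 1 ≤ n → μ[X (n + 1) | sigmaUpTo X n] =ᵐ[μ] fun ω => q * X 1 ω)
    {n : ℕ} (hn : 1 ≤ n) : μ[relativeStep X n | sigmaUpTo X n] =ᵐ[μ] fun _ => q := by
  have hZ : relativeStep X n = X (n + 1) * X 1 := by
    ext ω
    simp [relativeStep, show n ≠ 0 by omega]
  have hpull : μ[X (n + 1) * X 1 | sigmaUpTo X n] =ᵐ[μ] μ[X (n + 1) | sigmaUpTo X n] * X 1 :=
    condExp_mul_of_aestronglyMeasurable_right
      (measurable_sigmaUpTo le_rfl hn).stronglyMeasurable.aestronglyMeasurable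
      (hZ ▸ integrable_of_ae_eq_one_or_neg_one (measurable_relativeStep hX n)
        (relativeStep_eq_one_or_neg_one hval n))
      (integrable_of_ae_eq_one_or_neg_one (hX _) (hval _ (by omega)))
  rw [hZ]
  filter_upwards [hpull, hcond n hn, hval 1 le_rfl] with ω h1 h2 h3
  rw [h1, Pi.mul_apply, h2]
  rcases h3 with h3 | h3 <;> rw [h3] <;> ring

theorem iIndepFun_relativeStep (hX : ∀ i, Measurable (X i))
    (hval : ∀ i, 1 ≤ i → ∀ᵐ ω ∂μ, X i ω = 1 ∨ X i ω = -1)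
    (hcond : ∀ n, 1 ≤ n → μ[X (n + 1) | sigmaUpTo X n] =ᵐ[μ] fun ω => q * X 1 ω) :
    iIndepFun (relativeStep X) μ := by
  refine iIndep_of_indep_iSup_lt fun n => ?_
  rcases Nat.eq_zero_or_pos n with rfl | hn
  · simpa using indep_bot_left _
  · exact indep_of_indep_of_le_left
      (indep_comap_of_condExp_eq_const (sigmaUpTo_le hX n) (measurable_relativeStep hX n)
        (relativeStep_eq_one_or_neg_one hval n) (condExp_relativeStep hX hval hcond hn))
      (iSup₂_le fun k hk => comap_relativeStep_le hk)

theorem integral_relativeStep (hX : ∀ i, Measurable (X i))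
    (hval : ∀ i, 1 ≤ i → ∀ᵐ ω ∂μ, X i ω = 1 ∨ X i ω = -1) (hmean : ∫ ω, X 1 ω ∂μ = q)
    (hcond : ∀ n, 1 ≤ n → μ[X (n + 1) | sigmaUpTo X n] =ᵐ[μ] fun ω => q * X 1 ω) (n : ℕ) :
    ∫ ω, relativeStep X n ω ∂μ = q := by
  rcases Nat.eq_zero_or_pos n with rfl | hn
  · simpa [relativeStep] using hmean
  · rw [← integral_condExp (sigmaUpTo_le hX n),
      integral_congr_ae (condExp_relativeStep hX hval hcond hn)]
    simp

end RelativeStep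

theorem integral_eq_of_measure_eq_one {Ω : Type*} [MeasurableSpace Ω] {μ : Measure Ω}
    [IsProbabilityMeasure μ] {Z : Ω → ℝ} (hZ : Measurable Z)
    (hval : ∀ᵐ ω ∂μ, Z ω = 1 ∨ Z ω = -1) {p : ℝ} (hp : 0 ≤ p)
    (h : μ {ω | Z ω = 1} = ENNReal.ofReal p) : ∫ ω, Z ω ∂μ = 2 * p - 1 := by
  have hms : MeasurableSet {ω | Z ω = 1} := hZ (measurableSet_singleton 1)
  have hae : ∀ᵐ ω ∂μ, Z ω = 2 * {ω | Z ω = 1}.indicator (1 : Ω → ℝ) ω - 1 := by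
    filter_upwards [hval] with ω hω
    rcases hω with hω | hω <;> norm_num [Set.indicator_apply, hω]
  rw [integral_congr_ae hae, integral_sub _ (integrable_const _), integral_const_mul,
    integral_indicator_one hms]
  · simp [measureReal_def, h, hp]
  · exact ((integrable_const (1 : ℝ)).indicator hms).const_mul 2

namespace IsStandardBoundedSeq

variable {Ω : Type*} [MeasurableSpace Ω] {μ : Measure Ω} [IsProbabilityMeasure μ]
  {ξ : ℕ → Ω → ℝ} {C : ℝ}

theorem ae_lil_upper (h : IsStandardBoundedSeq μ ξ C) :
    ∀ᵐ ω ∂μ, ∀ d a : ℝ, 1 < a →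
      ∀ᶠ n : ℕ in atTop, (∑ i ∈ Finset.range n, ξ i ω + d) / lilScale n ≤ a := by
  have hae : ∀ᵐ ω ∂μ, ∀ m : ℕ, ∀ᶠ n : ℕ in atTop,
      ∑ i ∈ Finset.range n, ξ i ω ≤ (1 + 1 / ((m : ℝ) + 1)) * lilScale n :=
    ae_all_iff.2 fun m => h.ae_eventually_sum_le Nat.one_div_pos_of_nat
      (by simpa using Nat.one_div_le_one_div (α := ℝ) (Nat.zero_le m))
  filter_upwards [hae] with ω hω d a ha
  obtain ⟨m, hm⟩ := exists_nat_one_div_lt (sub_pos.2 ha)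
  have hscale := tendsto_lilScale_atTop.comp (tendsto_natCast_atTop_atTop (R := ℝ))
  filter_upwards [hω m, hscale.eventually_gt_atTop 0,
    (hscale.const_mul_atTop (sub_pos.2 hm)).eventually_ge_atTop d] with n h1 h2 h3
  simp only [Function.comp_apply] at h2 h3
  rw [div_le_iff₀ h2]
  linarith

theorem ae_lil_lower (h : IsStandardBoundedSeq μ ξ C) :
    ∀ᵐ ω ∂μ, ∀ d a : ℝ, a < 1 →
      ∃ᶠ n : ℕ in atTop, a ≤ (∑ i ∈ Finset.range n, ξ i ω + d) / lilScale n := by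
  have hae : ∀ᵐ ω ∂μ, ∀ m : ℕ, ∃ᶠ n : ℕ in atTop,
      (1 - 1 / ((m : ℝ) + 1)) * lilScale n ≤ ∑ i ∈ Finset.range n, ξ i ω :=
    ae_all_iff.2 fun m => h.ae_frequently_le_sum (sub_lt_self _ Nat.one_div_pos_of_nat)
  filter_upwards [hae] with ω hω d a ha
  obtain ⟨m, hm⟩ := exists_nat_one_div_lt (sub_pos.2 ha)
  have hscale := tendsto_lilScale_atTop.comp (tendsto_natCast_atTop_atTop (R := ℝ))
  refine ((hω m).and_eventually ((hscale.eventually_gt_atTop 0).and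
    ((hscale.const_mul_atTop (sub_pos.2 hm)).eventually_ge_atTop (-d)))).mono ?_
  rintro n ⟨h1, h2, h3⟩
  simp only [Function.comp_apply] at h2 h3
  rw [le_div_iff₀ h2]
  linarith

/-- The law of the iterated logarithm. -/
theorem ae_limsup_eq_one (h : IsStandardBoundedSeq μ ξ C) :
    ∀ᵐ ω ∂μ, ∀ d : ℝ,
      limsup (fun n : ℕ => (∑ i ∈ Finset.range n, ξ i ω + d) / lilScale n) atTop = 1 := by
  filter_upwards [h.ae_lil_upper, h.ae_lil_lower] with ω hup hlow d
  refine le_antisymm (le_of_forall_gt_imp_ge_of_dense fun a ha => ?_)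
    (le_of_forall_lt_imp_le_of_dense fun a ha => ?_)
  · exact limsup_le_of_le (.of_frequently_ge (hlow d 0 one_pos)) (hup d a ha)
  · exact le_limsup_of_frequently_le (hlow d a ha)
      (isBoundedUnder_of_eventually_le (hup d 2 one_lt_two))

theorem ae_liminf_eq_neg_one (h : IsStandardBoundedSeq μ ξ C) :
    ∀ᵐ ω ∂μ, ∀ d : ℝ,
      liminf (fun n : ℕ => (∑ i ∈ Finset.range n, ξ i ω + d) / lilScale n) atTop = -1 := by
  filter_upwards [h.neg.ae_lil_upper, h.neg.ae_lil_lower] with ω hup hlow d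
  have hneg (n : ℕ) : (∑ i ∈ Finset.range n, -ξ i ω + -d) / lilScale n =
      -((∑ i ∈ Finset.range n, ξ i ω + d) / lilScale n) := by
    rw [Finset.sum_neg_distrib]; ring
  have hup' (a : ℝ) (ha : a < -1) :
      ∀ᶠ n : ℕ in atTop, a ≤ (∑ i ∈ Finset.range n, ξ i ω + d) / lilScale n :=
    (hup (-d) (-a) (by linarith)).mono fun n hn => by
      rw [hneg] at hn; linarith
  have hlow' (a : ℝ) (ha : -1 < a) :
      ∃ᶠ n : ℕ in atTop, (∑ i ∈ Finset.range n, ξ i ω + d) / lilScale n ≤ a :=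
    (hlow (-d) (-a) (by linarith)).mono fun n hn => by
      rw [hneg] at hn; linarith
  refine le_antisymm (le_of_forall_gt_imp_ge_of_dense fun a ha => ?_)
    (le_of_forall_lt_imp_le_of_dense fun a ha => ?_)
  · exact liminf_le_of_frequently_le (hlow' a ha)
      (isBoundedUnder_of_eventually_ge (hup' (-2) (by norm_num)))
  · exact le_liminf_of_le (.of_frequently_le (hlow' 0 (by norm_num))) (hup' a ha)

theorem ae_tendsto_sum_div (h : IsStandardBoundedSeq μ ξ C) :
    ∀ᵐ ω ∂μ, Tendsto (fun n : ℕ => (∑ i ∈ Finset.range n, ξ i ω) / n) atTop (𝓝 0) := by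
  filter_upwards [h.ae_eventually_sum_le one_pos le_rfl,
    h.neg.ae_eventually_sum_le one_pos le_rfl] with ω hup hlow
  have hlim : Tendsto (fun n : ℕ => (1 + 1) * (lilScale n / n)) atTop (𝓝 0) := by
    simpa using (tendsto_lilScale_div_atTop.comp
      (tendsto_natCast_atTop_atTop (R := ℝ))).const_mul (1 + 1)
  refine squeeze_zero_norm' ?_ hlim
  filter_upwards [hup, hlow, eventually_gt_atTop 0] with n h1 h2 hn
  have hn' : (0 : ℝ) < n := by exact_mod_cast hn
  rw [Finset.sum_neg_distrib] at h2
  rw [Real.norm_eq_abs, abs_div, abs_of_pos hn', ← mul_div_assoc]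
  gcongr
  exact abs_le.2 ⟨by linarith, h1⟩

end IsStandardBoundedSeq

theorem integral_comp_mul_of_indepFun {Ω : Type*} [MeasurableSpace Ω] {μ : Measure Ω}
    [IsProbabilityMeasure μ] {Z V : Ω → ℝ} (hZ : Measurable Z) (hV : Measurable V)
    (hval : ∀ᵐ ω ∂μ, Z ω = 1 ∨ Z ω = -1) (hind : IndepFun Z V μ)
    (g : BoundedContinuousFunction ℝ ℝ) :
    ∫ ω, g (Z ω * V ω) ∂μ =
      (1 + ∫ ω, Z ω ∂μ) / 2 * ∫ ω, g (V ω) ∂μ + (1 - ∫ ω, Z ω ∂μ) / 2 * ∫ ω, g (-V ω) ∂μ := by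
  have hZi := integrable_of_ae_eq_one_or_neg_one hZ hval
  have hint {f W : Ω → ℝ} (hf : Integrable f μ) (hW : Measurable W) :
      Integrable (fun ω => f ω * g (W ω)) μ :=
    hf.mul_bdd (c := ‖g‖) (g.continuous.measurable.comp hW).aestronglyMeasurable
      (ae_of_all _ fun ω => g.norm_coe_le_norm _)
  have hprod {f k : ℝ → ℝ} (hf : Measurable f) (hk : Measurable k) :
      ∫ ω, f (Z ω) * k (V ω) ∂μ = (∫ ω, f (Z ω) ∂μ) * ∫ ω, k (V ω) ∂μ :=
    (hind.comp hf hk).integral_fun_mul_eq_mul_integral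
      (hf.comp hZ).aestronglyMeasurable (hk.comp hV).aestronglyMeasurable
  have hae : ∀ᵐ ω ∂μ, g (Z ω * V ω) =
      (1 + Z ω) / 2 * g (V ω) + (1 - Z ω) / 2 * g (-V ω) := by
    filter_upwards [hval] with ω hω
    rcases hω with hω | hω <;> rw [hω] <;> norm_num
  have hg := g.continuous.measurable
  rw [integral_congr_ae hae, integral_add, hprod (f := fun z => (1 + z) / 2) (by fun_prop) hg,
    hprod (f := fun z => (1 - z) / 2) (k := fun v => g (-v)) (by fun_prop) (hg.comp measurable_neg),
    integral_div, integral_div, integral_add (integrable_const _) hZi,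
    integral_sub (integrable_const _) hZi]
  · simp
  · exact hint (((integrable_const _).add hZi).div_const 2) hV
  · exact hint (((integrable_const _).sub hZi).div_const 2) hV.neg

theorem integral_comp_neg_gaussianReal (v : NNReal) (g : ℝ → ℝ) :
    ∫ x, g (-x) ∂(gaussianReal 0 v) = ∫ x, g x ∂(gaussianReal 0 v) := by
  have hmap : (gaussianReal 0 v).map (MeasurableEquiv.neg ℝ) = gaussianReal 0 v := by
    simpa using gaussianReal_map_neg (μ := 0) (v := v)
  conv_rhs => rw [← hmap, integral_map_equiv]
  rfl

/-- The relative steps, centred at `q` and rescaled to have unit variance. -/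
def standardizedStep {Ω : Type*} (X : ℕ → Ω → ℝ) (q : ℝ) (k : ℕ) (ω : Ω) : ℝ :=
  (relativeStep X k ω - q) / Real.sqrt (1 - q ^ 2)

section StandardizedStep

theorem partialSum_sub_eq {Ω : Type*} {X : ℕ → Ω → ℝ} {q : ℝ} (hq : 0 < 1 - q ^ 2) {n : ℕ}
    (hn : 1 ≤ n) {ω : Ω} (hω : X 1 ω = 1 ∨ X 1 ω = -1) :
    partialSum X n ω - n * q * X 1 ω =
      X 1 ω * (Real.sqrt (1 - q ^ 2) * ∑ k ∈ Finset.range n, standardizedStep X q k ω +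
        (1 - X 1 ω)) := by
  have hs : Real.sqrt (1 - q ^ 2) ≠ 0 := (Real.sqrt_pos.2 hq).ne'
  have hsq : X 1 ω * X 1 ω = 1 := by rcases hω with h | h <;> rw [h] <;> norm_num
  induction n, hn using Nat.le_induction with
  | base =>
    simp only [partialSum, standardizedStep, relativeStep, Finset.Icc_self, Finset.sum_singleton,
      Finset.sum_range_one, mul_div_cancel₀ _ hs, if_true, Nat.cast_one]
    ring
  | succ n hn ih =>
    have hstep : X (n + 1) ω = X 1 ω * relativeStep X n ω := by
      simp only [relativeStep, show n ≠ 0 by omega, if_false]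
      linear_combination -X (n + 1) ω * hsq
    have hpart : partialSum X (n + 1) ω = partialSum X n ω + X (n + 1) ω :=
      Finset.sum_Icc_succ_top (by omega) _
    rw [hpart, Finset.sum_range_succ, mul_add (Real.sqrt _), standardizedStep, mul_div_cancel₀ _ hs,
      hstep]
    push_cast
    linear_combination ih

variable {Ω : Type*} [MeasurableSpace Ω] {μ : Measure Ω} [IsProbabilityMeasure μ]
  {X : ℕ → Ω → ℝ} {q : ℝ}

theorem isStandardBoundedSeq_standardizedStep (hq : 0 < 1 - q ^ 2) (hX : ∀ i, Measurable (X i))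
    (hval : ∀ i, 1 ≤ i → ∀ᵐ ω ∂μ, X i ω = 1 ∨ X i ω = -1) (hmean : ∫ ω, X 1 ω ∂μ = q)
    (hcond : ∀ n, 1 ≤ n → μ[X (n + 1) | sigmaUpTo X n] =ᵐ[μ] fun ω => q * X 1 ω) :
    IsStandardBoundedSeq μ (standardizedStep X q) (2 / Real.sqrt (1 - q ^ 2)) := by
  have hs : 0 < Real.sqrt (1 - q ^ 2) := Real.sqrt_pos.2 hq
  have hq1 : |q| ≤ 1 := abs_le_one_iff_mul_self_le_one.2 (by nlinarith)
  have hZ := relativeStep_eq_one_or_neg_one hval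
  have hZm := measurable_relativeStep hX
  have hZint k := integral_relativeStep hX hval hmean hcond k
  have hZi k := integrable_of_ae_eq_one_or_neg_one (hZm k) (hZ k)
  refine ⟨?_, fun k => ((hZm k).sub_const q).div_const _, fun k => ?_, fun k => ?_, fun k => ?_, ?_⟩
  · rw [le_div_iff₀ hs, one_mul]
    exact Real.sqrt_le_iff.2 ⟨by norm_num, by nlinarith [sq_nonneg q]⟩
  · filter_upwards [hZ k] with ω hω
    rw [standardizedStep, abs_div, abs_of_pos hs]
    gcongr
    refine (abs_sub _ _).trans ?_
    rcases hω with hω | hω <;> rw [hω] <;> norm_num <;> linarith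
  · simp only [standardizedStep]
    rw [integral_div, integral_sub (hZi k) (integrable_const _), hZint]
    simp
  · have hae : ∀ᵐ ω ∂μ, standardizedStep X q k ω ^ 2 =
        (1 + q ^ 2 - 2 * q * relativeStep X k ω) / (1 - q ^ 2) := by
      filter_upwards [hZ k] with ω hω
      rw [standardizedStep, div_pow, Real.sq_sqrt hq.le]
      rcases hω with hω | hω <;> rw [hω] <;> ring
    rw [integral_congr_ae hae, integral_div,
      integral_sub (integrable_const _) ((hZi k).const_mul _), integral_const_mul, hZint]
    simp only [integral_const, probReal_univ, one_smul]
    rw [div_eq_one_iff_eq hq.ne']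
    ring
  · exact (iIndepFun_relativeStep hX hval hcond).comp
      (fun _ z => (z - q) / Real.sqrt (1 - q ^ 2)) fun _ => by fun_prop

theorem tendstoInDistribution_standardizedStep (hq : 0 < 1 - q ^ 2) (hX : ∀ i, Measurable (X i))
    (hval : ∀ i, 1 ≤ i → ∀ᵐ ω ∂μ, X i ω = 1 ∨ X i ω = -1) (hmean : ∫ ω, X 1 ω ∂μ = q)
    (hcond : ∀ n, 1 ≤ n → μ[X (n + 1) | sigmaUpTo X n] =ᵐ[μ] fun ω => q * X 1 ω) :
    MeasureTheory.TendstoInDistribution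
      (fun (n : ℕ) ω => (Real.sqrt n)⁻¹ * ∑ k ∈ Finset.range n, standardizedStep X q k ω)
      atTop id (fun _ => μ) (gaussianReal 0 1) := by
  have hstd := isStandardBoundedSeq_standardizedStep hq hX hval hmean hcond
  refine tendstoInDistribution_inv_sqrt_mul_sum .id (hstd.mean 0) (hstd.second_moment 0)
    hstd.indep fun k => ?_
  refine (identDistrib_of_ae_eq_one_or_neg_one (measurable_relativeStep hX k)
    (measurable_relativeStep hX 0) (relativeStep_eq_one_or_neg_one hval k)
    (relativeStep_eq_one_or_neg_one hval 0) ?_).comp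
    (u := fun z => (z - q) / Real.sqrt (1 - q ^ 2)) (by fun_prop)
  rw [integral_relativeStep hX hval hmean hcond, integral_relativeStep hX hval hmean hcond]

/-- The normalized walk is the product of its first step with an independent variable that is
asymptotically standard normal. -/
theorem tendstoInDistribution_partialSum (hq : 0 < 1 - q ^ 2) (hX : ∀ i, Measurable (X i))
    (hval : ∀ i, 1 ≤ i → ∀ᵐ ω ∂μ, X i ω = 1 ∨ X i ω = -1) (hmean : ∫ ω, X 1 ω ∂μ = q)
    (hcond : ∀ n, 1 ≤ n → μ[X (n + 1) | sigmaUpTo X n] =ᵐ[μ] fun ω => q * X 1 ω) :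
    _root_.TendstoInDistribution μ
      (fun n ω => (partialSum X n ω - n * q * X 1 ω) / (Real.sqrt (1 - q ^ 2) * Real.sqrt n))
      (gaussianReal 0 1) := by
  have hstd := isStandardBoundedSeq_standardizedStep hq hX hval hmean hcond
  have hs : 0 < Real.sqrt (1 - q ^ 2) := Real.sqrt_pos.2 hq
  set s := Real.sqrt (1 - q ^ 2) with hsdef
  set ξ := standardizedStep X q with hξ
  have hsqrt : Tendsto (fun n : ℕ => Real.sqrt n) atTop atTop :=
    Real.tendsto_sqrt_atTop.comp tendsto_natCast_atTop_atTop
  let V : ℕ → Ω → ℝ := fun n ω =>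
    (∑ k ∈ (Finset.range n).erase 0, ξ k ω + (1 - q) / s) / Real.sqrt n
  let R : ℕ → Ω → ℝ := fun n ω => ((1 - q) / s - ξ 0 ω) / Real.sqrt n
  have hVm n : Measurable (V n) :=
    ((Finset.measurable_fun_sum _ fun i _ => hstd.measurable i).add_const _).div_const _
  have hRm n : Measurable (R n) := ((hstd.measurable 0).const_sub _).div_const _
  have hVR n ω (hn : 1 ≤ n) :
      V n ω = (Real.sqrt n)⁻¹ * ∑ k ∈ Finset.range n, ξ k ω + R n ω := by
    simp only [V, R]
    rw [← Finset.add_sum_erase _ _ (Finset.mem_range.2 hn)]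
    ring
  have hdist : MeasureTheory.TendstoInDistribution
      ((fun (n : ℕ) ω => (Real.sqrt n)⁻¹ * ∑ k ∈ Finset.range n, ξ k ω) + R)
      atTop (fun x : ℝ => id x + 0) (fun _ => μ) (gaussianReal 0 1) := by
    refine (tendstoInDistribution_standardizedStep hq hX hval hmean
      hcond).add_of_tendstoInMeasure_const ?_ fun n => (hRm n).aemeasurable
    exact tendstoInMeasure_of_tendsto_ae (fun n => (hRm n).aestronglyMeasurable)
      (ae_of_all _ fun ω => hsqrt.const_div_atTop _)
  have hV (g : BoundedContinuousFunction ℝ ℝ) :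
      Tendsto (fun n => ∫ ω, g (V n ω) ∂μ) atTop (𝓝 (∫ x, g x ∂(gaussianReal 0 1))) := by
    have hg := ProbabilityMeasure.tendsto_iff_forall_integral_tendsto.1 hdist.tendsto g
    simp only [id, add_zero, ProbabilityMeasure.coe_mk] at hg
    rw [Measure.map_id'] at hg
    refine hg.congr' ?_
    filter_upwards [eventually_ge_atTop 1] with n hn
    rw [integral_map (hdist.forall_aemeasurable n) g.continuous.aestronglyMeasurable]
    simp only [hVR n _ hn, Pi.add_apply]
  have hind n : IndepFun (X 1) (V n) μ := by
    have h := (hstd.indep.indepFun_finsetSum_of_notMem hstd.measurable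
      (Finset.notMem_erase 0 (Finset.range n))).symm
    have h' := h.comp (φ := fun z => s * z + q)
      (ψ := fun z => (z + (1 - q) / s) / Real.sqrt n) (by fun_prop) (by fun_prop)
    convert h' using 1
    · ext ω
      simp only [hξ, standardizedStep, relativeStep, Function.comp_apply, if_true, ← hsdef]
      field_simp
      ring
    · ext ω
      simp [V]
  intro g
  have hlim := ((hV g).const_mul ((1 + q) / 2)).add
    ((hV (g.compContinuous ⟨fun x => -x, continuous_neg⟩)).const_mul ((1 - q) / 2))
  simp only [BoundedContinuousFunction.compContinuous_apply, ContinuousMap.coe_mk,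
    integral_comp_neg_gaussianReal] at hlim
  rw [← add_mul, show (1 + q) / 2 + (1 - q) / 2 = 1 by ring, one_mul] at hlim
  refine hlim.congr' ?_
  filter_upwards [eventually_ge_atTop 1] with n hn
  have hn' : 0 < Real.sqrt n := Real.sqrt_pos.2 (by exact_mod_cast hn)
  have h1 := integral_comp_mul_of_indepFun (hX 1) (hVm n) (hval 1 le_rfl) (hind n) g
  rw [hmean] at h1
  rw [← h1]
  refine integral_congr_ae ?_
  filter_upwards [hval 1 le_rfl] with ω hω
  congr 1
  rw [partialSum_sub_eq hq hn hω, hVR n ω hn, ← hsdef]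
  simp only [R, hξ]
  have h0 : standardizedStep X q 0 ω = (X 1 ω - q) / s := by
    simp [standardizedStep, relativeStep, hsdef]
  rw [h0]
  field_simp
  ring

theorem ae_tendsto_partialSum_sub_div (hq : 0 < 1 - q ^ 2) (hX : ∀ i, Measurable (X i))
    (hval : ∀ i, 1 ≤ i → ∀ᵐ ω ∂μ, X i ω = 1 ∨ X i ω = -1) (hmean : ∫ ω, X 1 ω ∂μ = q)
    (hcond : ∀ n, 1 ≤ n → μ[X (n + 1) | sigmaUpTo X n] =ᵐ[μ] fun ω => q * X 1 ω) :
    ∀ᵐ ω ∂μ, Tendsto (fun n : ℕ => (partialSum X n ω - n * q * X 1 ω) / n) atTop (𝓝 0) := by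
  filter_upwards [hval 1 le_rfl,
    (isStandardBoundedSeq_standardizedStep hq hX hval hmean hcond).ae_tendsto_sum_div]
    with ω hω hlim
  have h := ((hlim.const_mul (Real.sqrt (1 - q ^ 2))).add
    (tendsto_const_div_atTop_nhds_zero_nat (1 - X 1 ω))).const_mul (X 1 ω)
  rw [mul_zero, add_zero, mul_zero] at h
  refine h.congr' ?_
  filter_upwards [eventually_ge_atTop 1] with n hn
  rw [partialSum_sub_eq hq hn hω]
  ring

theorem ae_lil_partialSum (hq : 0 < 1 - q ^ 2) (hX : ∀ i, Measurable (X i))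
    (hval : ∀ i, 1 ≤ i → ∀ᵐ ω ∂μ, X i ω = 1 ∨ X i ω = -1) (hmean : ∫ ω, X 1 ω ∂μ = q)
    (hcond : ∀ n, 1 ≤ n → μ[X (n + 1) | sigmaUpTo X n] =ᵐ[μ] fun ω => q * X 1 ω) :
    ∀ᵐ ω ∂μ,
      limsup (fun n : ℕ => (partialSum X n ω - n * q * X 1 ω) /
        (Real.sqrt (1 - q ^ 2) * lilScale n)) atTop = 1 ∧
      liminf (fun n : ℕ => (partialSum X n ω - n * q * X 1 ω) /
        (Real.sqrt (1 - q ^ 2) * lilScale n)) atTop = -1 := by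
  have hstd := isStandardBoundedSeq_standardizedStep hq hX hval hmean hcond
  have hs : Real.sqrt (1 - q ^ 2) ≠ 0 := (Real.sqrt_pos.2 hq).ne'
  filter_upwards [hval 1 le_rfl, hstd.ae_limsup_eq_one, hstd.ae_liminf_eq_neg_one,
    hstd.neg.ae_limsup_eq_one, hstd.neg.ae_liminf_eq_neg_one] with ω hω h1 h2 h3 h4
  rcases hω with hω | hω
  · have hae : (fun n : ℕ => (partialSum X n ω - n * q * X 1 ω) /
        (Real.sqrt (1 - q ^ 2) * lilScale n)) =ᶠ[atTop]
        fun n : ℕ => (∑ k ∈ Finset.range n, standardizedStep X q k ω + 0) / lilScale n := by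
      filter_upwards [eventually_ge_atTop 1] with n hn
      rw [partialSum_sub_eq hq hn (.inl hω), hω, sub_self, add_zero, add_zero, one_mul,
        mul_div_mul_left _ _ hs]
    rw [limsup_congr hae, liminf_congr hae]
    exact ⟨h1 0, h2 0⟩
  · have hae : (fun n : ℕ => (partialSum X n ω - n * q * X 1 ω) /
        (Real.sqrt (1 - q ^ 2) * lilScale n)) =ᶠ[atTop]
        fun n : ℕ => (∑ k ∈ Finset.range n, -standardizedStep X q k ω +
          -2 / Real.sqrt (1 - q ^ 2)) / lilScale n := by
      filter_upwards [eventually_ge_atTop 1] with n hn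
      rw [partialSum_sub_eq hq hn (.inr hω), hω, Finset.sum_neg_distrib,
        ← mul_div_mul_left _ (lilScale n) hs, mul_add (Real.sqrt _), mul_div_cancel₀ _ hs]
      ring
    rw [limsup_congr hae, liminf_congr hae]
    exact ⟨h3 _, h4 _⟩

end StandardizedStep

/-- for the elephant random walk remembering only the first step, with random
first step `P(X₁ = 1) = p = 1 - P(X₁ = -1)`: (a) `(Sₙ - n(2p-1)X₁)/√(4np(1-p)) → N(0,1)` in
distribution; (b) `(Sₙ - n(2p-1)X₁)/n → 0` a.s.; (c) the LIL: the limsup (resp. liminf) of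
`(Sₙ - n(2p-1)X₁)/√(8np(1-p) log log n)` equals `1` (resp. `-1`) a.s. -/
theorem elephant_first_step_random_start_clt
    {Ω : Type*} [MeasurableSpace Ω] (μ : Measure Ω) [IsProbabilityMeasure μ]
    (p : ℝ) (hp0 : 0 < p) (hp1 : p < 1)
    (X : ℕ → Ω → ℝ)
    (hXmeas : ∀ i, Measurable (X i))
    (hval : ∀ i, 1 ≤ i → ∀ᵐ ω ∂μ, X i ω = 1 ∨ X i ω = -1)
    (hinit : μ {ω | X 1 ω = 1} = ENNReal.ofReal p)
    (hcond : ∀ n, 1 ≤ n →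
      μ[X (n+1) | sigmaUpTo X n] =ᵐ[μ] fun ω => (2*p-1) * X 1 ω) :
    TendstoInDistribution μ
      (fun n ω => (partialSum X n ω - n*(2*p-1)*X 1 ω) / Real.sqrt (4*n*p*(1-p)))
      (gaussianReal 0 1) ∧
    (∀ᵐ ω ∂μ, Tendsto
      (fun n : ℕ => (partialSum X n ω - n*(2*p-1)*X 1 ω) / n) atTop (𝓝 0)) ∧
    (∀ᵐ ω ∂μ,
      limsup (fun n : ℕ =>
        (partialSum X n ω - n*(2*p-1)*X 1 ω) /
          Real.sqrt (8*n*p*(1-p)*Real.log (Real.log n))) atTop = 1 ∧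
      liminf (fun n : ℕ =>
        (partialSum X n ω - n*(2*p-1)*X 1 ω) /
          Real.sqrt (8*n*p*(1-p)*Real.log (Real.log n))) atTop = -1) := by
  have hq : 1 - (2 * p - 1) ^ 2 = 4 * p * (1 - p) := by ring
  have hpos : 0 < 1 - (2 * p - 1) ^ 2 := by
    rw [hq]
    exact mul_pos (by linarith) (by linarith)
  have hmean := integral_eq_of_measure_eq_one (hXmeas 1) (hval 1 le_rfl) hp0.le hinit
  refine ⟨?_, ae_tendsto_partialSum_sub_div hpos hXmeas hval hmean hcond, ?_⟩
  · convert tendstoInDistribution_partialSum hpos hXmeas hval hmean hcond using 4 with n ω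
    rw [← Real.sqrt_mul hpos.le, hq]
    ring_nf
  · have hscale (n : ℕ) : Real.sqrt (8 * n * p * (1 - p) * Real.log (Real.log n)) =
        Real.sqrt (1 - (2 * p - 1) ^ 2) * lilScale n := by
      rw [lilScale, ← Real.sqrt_mul hpos.le, hq]
      ring_nf
    simp only [hscale]
    exact ae_lil_partialSum hpos hXmeas hval hmean hcond
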